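/- arXiv:2406.01575 — 6 statements merged into one kernel-verified Lean document; each statement's English description precedes it below -/
import Mathlib

section
/- Let S and A be finite nonempty sets, γ ∈ [0,1), λ > 0, and x₀ ∈ ℝ. Let π : S → A → ℝ be a policy such that π(s,·) is a probability vector for every s. Let r : ℝ → S → A → ℝ and P : ℝ → S → A → S → ℝ be such that P(x)(s,a,·) is a probability vector for every x, s, a, and such that x ↦ r(x)(s,a) and x ↦ P(x)(s,a,s') are differentiable at x₀ for all s, a, s'. Suppose Q : ℝ → S → A → ℝ and V : ℝ → S → ℝ satisfy, for every x ∈ ℝ, the entropy-regularized Bellman equations for π (with reward r(x) and kernel P(x)): Q(x)(s,a) = r(x)(s,a) + γ·Σ_{s'} P(x)(s,a,s')·V(x)(s') and V(x)(s) = Σ_a π(s,a)·Q(x)(s,a) + λ·H(π(s,·)), and suppose x ↦ Q(x)(s,a) is differentiable at x₀ for every (s,a). Let M be the (S×A)×(S×A) real matrix M((s,a),(s',a')) = P(x₀)(s,a,s')·π(s',a'). Then for every (s,a), the series Σ_{t=0}^∞ γ^t · Σ_{(s',a')} (M^t)((s,a),(s',a')) · [ ∂ₓr(x₀)(s',a')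 + γ·Σ_{s''} ∂ₓP(x₀)(s',a',s'')·V(x₀)(s'') ] converges absolutely and equals the derivative of x ↦ Q(x)(s,a) at x₀. -/
open Matrix in
/-- A row-stochastic matrix does not increase the sup norm of a vector. -/
theorem abs_mulVec_le_of_mem_rowStochastic {n : Type*} [Fintype n] [DecidableEq n]
    {M : Matrix n n ℝ} (hM : M ∈ rowStochastic ℝ n) {v : n → ℝ} {C : ℝ}
    (hv : ∀ j, |v j| ≤ C) (i : n) : |(M *ᵥ v) i| ≤ C := by
  have hsum : ∑ j, M i j = 1 := sum_row_of_mem_rowStochastic hM i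
  calc |∑ j, M i j * v j| ≤ ∑ j, |M i j * v j| := Finset.abs_sum_le_sum_abs _ _
    _ ≤ ∑ j, M i j * C := by
        refine Finset.sum_le_sum fun j _ => ?_
        rw [abs_mul, abs_of_nonneg (nonneg_of_mem_rowStochastic hM)]
        exact mul_le_mul_of_nonneg_left (hv j) (nonneg_of_mem_rowStochastic hM)
    _ = C := by rw [← Finset.sum_mul, hsum, one_mul]

open Matrix in
/-- The discounted powers of a row-stochastic matrix applied to a vector decay geometrically. -/
theorem exists_abs_pow_mulVec_le_of_mem_rowStochastic {n : Type*} [Fintype n] [DecidableEq n]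
    {M : Matrix n n ℝ} (hM : M ∈ rowStochastic ℝ n) {γ : ℝ} (hγ : 0 ≤ γ) (v : n → ℝ) :
    ∃ C : ℝ, ∀ (t : ℕ) (i : n), |γ ^ t * (M ^ t *ᵥ v) i| ≤ γ ^ t * C := by
  refine ⟨‖v‖, fun t i => ?_⟩
  rw [abs_mul, abs_of_nonneg (pow_nonneg hγ t)]
  exact mul_le_mul_of_nonneg_left
    (abs_mulVec_le_of_mem_rowStochastic (pow_mem hM t) (norm_le_pi_norm v) i) (pow_nonneg hγ t)

open Matrix in
theorem summable_abs_pow_mulVec_of_mem_rowStochastic {n : Type*} [Fintype n] [DecidableEq n]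
    {M : Matrix n n ℝ} (hM : M ∈ rowStochastic ℝ n) {γ : ℝ} (hγ : γ ∈ Set.Ico (0 : ℝ) 1)
    (v : n → ℝ) (i : n) : Summable fun t : ℕ => |γ ^ t * (M ^ t *ᵥ v) i| := by
  obtain ⟨C, hC⟩ := exists_abs_pow_mulVec_le_of_mem_rowStochastic hM hγ.1 v
  exact .of_nonneg_of_le (fun _ => abs_nonneg _) (fun t => hC t i)
    ((summable_geometric_of_lt_one hγ.1 hγ.2).mul_right C)

open Matrix in
/-- The Neumann series of a discounted row-stochastic matrix solves the fixed-point equation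
`w = b + γ • M *ᵥ w`. -/
theorem hasSum_pow_mulVec_of_mem_rowStochastic {n : Type*} [Fintype n] [DecidableEq n]
    {M : Matrix n n ℝ} (hM : M ∈ rowStochastic ℝ n) {γ : ℝ} (hγ : γ ∈ Set.Ico (0 : ℝ) 1)
    {b w : n → ℝ} (hw : w = b + γ • M *ᵥ w) (i : n) :
    HasSum (fun t : ℕ => γ ^ t * (M ^ t *ᵥ b) i) (w i) := by
  rw [(summable_abs_pow_mulVec_of_mem_rowStochastic hM hγ b i).of_abs.hasSum_iff_tendsto_nat]
  have hpartial (N : ℕ) : ∑ t ∈ Finset.range N, γ ^ t * (M ^ t *ᵥ b) i =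
      w i - γ ^ N * (M ^ N *ᵥ w) i := by
    induction N with
    | zero => simp
    | succ N ih =>
      have hstep : (M ^ N *ᵥ w) i = (M ^ N *ᵥ b) i + γ * (M ^ (N + 1) *ᵥ w) i := by
        conv_lhs => rw [hw]
        rw [mulVec_add, mulVec_smul, mulVec_mulVec, ← pow_succ]
        rfl
      rw [Finset.sum_range_succ, ih, hstep]
      ring
  simp_rw [hpartial]
  simpa using tendsto_const_nhds.sub
    (summable_abs_pow_mulVec_of_mem_rowStochastic hM hγ w i).of_abs.tendsto_atTop_zero


/-- Trajectory-expectation formula for the parameter-derivative of the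
entropy-regularized Q-function (Theorem 3.2), in matrix-power form. -/
theorem soft_Q_derivative_series
    {S A : Type*} [Fintype S] [Nonempty S] [DecidableEq S]
    [Fintype A] [Nonempty A] [DecidableEq A]
    (γ : ℝ) (hγ : γ ∈ Set.Ico (0 : ℝ) 1) (lam : ℝ) (hlam : 0 < lam) (x₀ : ℝ)
    (pol : S → A → ℝ)
    (hpol_nonneg : ∀ s a, 0 ≤ pol s a) (hpol_sum : ∀ s, ∑ a, pol s a = 1)
    (r : ℝ → S → A → ℝ) (P : ℝ → S → A → S → ℝ)
    (hP_nonneg : ∀ x s a s', 0 ≤ P x s a s')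
    (hP_sum : ∀ x s a, ∑ s', P x s a s' = 1)
    (r' : S → A → ℝ) (P' : S → A → S → ℝ)
    (hr' : ∀ s a, HasDerivAt (fun x => r x s a) (r' s a) x₀)
    (hP' : ∀ s a s', HasDerivAt (fun x => P x s a s') (P' s a s') x₀)
    (Q : ℝ → S → A → ℝ) (V : ℝ → S → ℝ)
    (hQ : ∀ x s a, Q x s a = r x s a + γ * ∑ s', P x s a s' * V x s')
    (hV : ∀ x s, V x s = ∑ a, pol s a * Q x s a +
      lam * (-∑ a, pol s a * Real.log (pol s a)))
    (Qd : S → A → ℝ)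
    (hQd : ∀ s a, HasDerivAt (fun x => Q x s a) (Qd s a) x₀)
    (M : Matrix (S × A) (S × A) ℝ)
    (hM : ∀ p q : S × A, M p q = P x₀ p.1 p.2 q.1 * pol q.1 q.2) :
    ∀ s a,
      Summable (fun t : ℕ => |γ ^ t * ∑ q : S × A, (M ^ t) (s, a) q *
          (r' q.1 q.2 + γ * ∑ s'', P' q.1 q.2 s'' * V x₀ s'')|) ∧
      HasSum (fun t : ℕ => γ ^ t * ∑ q : S × A, (M ^ t) (s, a) q *
          (r' q.1 q.2 + γ * ∑ s'', P' q.1 q.2 s'' * V x₀ s'')) (Qd s a) := by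
  have hMs : M ∈ Matrix.rowStochastic ℝ (S × A) := by
    refine Matrix.mem_rowStochastic_iff_sum.2 ⟨fun p q => ?_, fun p => ?_⟩
    · rw [hM]
      exact mul_nonneg (hP_nonneg ..) (hpol_nonneg ..)
    · simp_rw [hM, Fintype.sum_prod_type, ← Finset.mul_sum, hpol_sum, mul_one, hP_sum]
  have hVd (s : S) : HasDerivAt (fun x => V x s) (∑ a, pol s a * Qd s a) x₀ := by
    simp_rw [hV]
    exact (HasDerivAt.fun_sum fun a _ => (hQd s a).const_mul (pol s a)).add_const _
  have hbellman (s : S) (a : A) : Qd s a = r' s a + γ * ∑ s',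
      (P' s a s' * V x₀ s' + P x₀ s a s' * ∑ a', pol s' a' * Qd s' a') := by
    refine (hQd s a).unique ?_
    simp_rw [hQ]
    exact (hr' s a).add
      ((HasDerivAt.fun_sum fun s' _ => (hP' s a s').mul (hVd s')).const_mul γ)
  have hfix : (fun q : S × A => Qd q.1 q.2) =
      (fun q : S × A => r' q.1 q.2 + γ * ∑ s'', P' q.1 q.2 s'' * V x₀ s'') +
        γ • M.mulVec (fun q : S × A => Qd q.1 q.2) := by
    funext q
    have hmul : M.mulVec (fun q : S × A => Qd q.1 q.2) q =
        ∑ s', P x₀ q.1 q.2 s' * ∑ a', pol s' a' * Qd s' a' := by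
      simp only [Matrix.mulVec, dotProduct, hM, Fintype.sum_prod_type, Finset.mul_sum, mul_assoc]
    rw [Pi.add_apply, Pi.smul_apply, hmul, smul_eq_mul, hbellman, Finset.sum_add_distrib]
    ring
  exact fun s a => ⟨summable_abs_pow_mulVec_of_mem_rowStochastic hMs hγ _ (s, a),
    hasSum_pow_mulVec_of_mem_rowStochastic hMs hγ hfix (s, a)⟩
end

section
/- Fix finite nonempty sets S (states) and A (actions), a reward function r : S → A → ℝ, a transition kernel P : S → A → S → ℝ such that P(s,a,·) is a probability vector for every (s,a), a discount factor γ ∈ [0,1), a regularization parameter λ > 0, and R̄ ≥ 0 with |r(s,a)| ≤ R̄ for all (s,a). Define the soft Bellman value operator 𝒯 on functions V : S → ℝ by (𝒯V)(s) = λ·log( Σ_a exp( (r(s,a) + γ·Σ_{s'} P(s,a,s')·V(s')) / λ ) ). Let V* : S → ℝ satisfy 𝒯V* = V*, and for T ∈ ℕ let V_T = 𝒯^T(0) be the T-fold iterate of 𝒯 applied to the zero function. Define Q_T(s,a) = r(s,a) + γ·Σ_{s'} P(s,a,s')·V_T(s') and Q*(s,a) = r(s,a) + γ·Σ_{s'}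 P(s,a,s')·V*(s'), and the softmax policies π_T(s,a) = exp(Q_T(s,a)/λ)/Σ_b exp(Q_T(s,b)/λ) and π*(s,a) = exp(Q*(s,a)/λ)/Σ_b exp(Q*(s,b)/λ). Then for all s ∈ S and a ∈ A: |π_T(s,a) − π*(s,a)| ≤ γ^T · (R̄ + λ·log|A|) / (λ·(1−γ)). -/
/-- The scalar inequality `tanh ε ≤ ε`, written with exponentials. -/
lemma one_sub_exp_neg_two_mul_le {ε : ℝ} (hε : 0 ≤ ε) :
    1 - Real.exp (-(2 * ε)) ≤ ε * (1 + Real.exp (-(2 * ε))) := by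
  let f : ℝ → ℝ := fun x => x * (1 + Real.exp (-(2 * x))) - (1 - Real.exp (-(2 * x)))
  have hd (x : ℝ) : HasDerivAt f (1 - Real.exp (-(2 * x)) * (1 + 2 * x)) x := by
    have he : HasDerivAt (fun x : ℝ => Real.exp (-(2 * x))) (Real.exp (-(2 * x)) * -(2 * 1)) x :=
      ((hasDerivAt_id x).const_mul 2).neg.exp
    refine (((hasDerivAt_id' x).mul (he.const_add 1)).sub (he.const_sub 1)).congr_deriv ?_
    ring
  have hmono : Monotone f := by
    refine monotone_of_deriv_nonneg (fun x => (hd x).differentiableAt) fun x => ?_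
    rw [(hd x).deriv, sub_nonneg]
    calc Real.exp (-(2 * x)) * (1 + 2 * x)
        ≤ Real.exp (-(2 * x)) * Real.exp (2 * x) := by
          gcongr
          linarith [Real.add_one_le_exp (2 * x)]
      _ = 1 := by rw [← Real.exp_add]; simp
  have h := hmono hε
  simp only [f, mul_zero, neg_zero, Real.exp_zero] at h
  linarith

/-- If `u / u'` exceeds `v / v'` by a factor of at most `exp (2 * ε)`, then the corresponding
normalized weights differ by at most `ε`. -/
lemma div_add_sub_div_add_le {u u' v v' ε : ℝ} (hu : 0 < u) (hu' : 0 ≤ u') (hv : 0 < v)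
    (hv' : 0 ≤ v') (hε : 0 ≤ ε) (h : Real.exp (-(2 * ε)) * (u * v') ≤ v * u') :
    u / (u + u') - v / (v + v') ≤ ε := by
  have hc := one_sub_exp_neg_two_mul_le hε
  have hc0 := Real.exp_pos (-(2 * ε))
  set c := Real.exp (-(2 * ε))
  rw [div_sub_div _ _ (by positivity) (by positivity), div_le_iff₀ (by positivity)]
  have hX : 0 ≤ u * v' := by positivity
  have hcross : u * v' - v * u' ≤ ε * (u * v' + v * u') := by
    nlinarith [mul_le_mul_of_nonneg_right hc hX, mul_le_mul_of_nonneg_left h hε]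
  nlinarith [mul_nonneg hε (mul_nonneg hu.le hv.le), mul_nonneg hε (mul_nonneg hu' hv')]

/-- Each coordinate of the softmax map is `1`-Lipschitz for the sup norm (one-sided form). -/
lemma softmax_sub_le {A : Type*} [Fintype A] {x y : A → ℝ} {ε : ℝ}
    (h : ∀ a, |x a - y a| ≤ ε) (a : A) :
    Real.exp (x a) / ∑ b, Real.exp (x b) - Real.exp (y a) / ∑ b, Real.exp (y b) ≤ ε := by
  classical
  rw [← Finset.add_sum_erase _ _ (Finset.mem_univ a),
    ← Finset.add_sum_erase _ (fun b => Real.exp (y b)) (Finset.mem_univ a)]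
  refine div_add_sub_div_add_le (Real.exp_pos _) (by positivity) (Real.exp_pos _)
    (by positivity) ((abs_nonneg _).trans (h a)) ?_
  simp only [Finset.mul_sum, ← Real.exp_add]
  refine Finset.sum_le_sum fun b _ => Real.exp_le_exp.2 ?_
  linarith [(abs_le.1 (h a)).2, (abs_le.1 (h b)).1]

/-- Each coordinate of the softmax map is `1`-Lipschitz for the sup norm. -/
lemma abs_softmax_sub_le {A : Type*} [Fintype A] {x y : A → ℝ} {ε : ℝ}
    (h : ∀ a, |x a - y a| ≤ ε) (a : A) :
    |Real.exp (x a) / ∑ b, Real.exp (x b) - Real.exp (y a) / ∑ b, Real.exp (y b)| ≤ ε :=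
  abs_sub_le_iff.2 ⟨softmax_sub_le h a, softmax_sub_le (fun b => abs_sub_comm (x b) _ ▸ h b) a⟩

/-- The log-sum-exp function is `1`-Lipschitz for the sup norm (one-sided form). -/
lemma log_sum_exp_sub_le {A : Type*} [Fintype A] [Nonempty A] {x y : A → ℝ} {ε : ℝ}
    (h : ∀ a, x a - y a ≤ ε) :
    Real.log (∑ a, Real.exp (x a)) - Real.log (∑ a, Real.exp (y a)) ≤ ε := by
  have hpos (z : A → ℝ) : 0 < ∑ a, Real.exp (z a) :=
    Finset.sum_pos (fun a _ => Real.exp_pos _) Finset.univ_nonempty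
  rw [← Real.log_div (hpos x).ne' (hpos y).ne', Real.log_le_iff_le_exp (div_pos (hpos x) (hpos y)),
    div_le_iff₀ (hpos y), Finset.mul_sum]
  refine Finset.sum_le_sum fun a _ => ?_
  rw [← Real.exp_add]
  exact Real.exp_le_exp.2 (by linarith [h a])

/-- The log-sum-exp function is `1`-Lipschitz for the sup norm. -/
lemma abs_log_sum_exp_sub_le {A : Type*} [Fintype A] [Nonempty A] {x y : A → ℝ} {ε : ℝ}
    (h : ∀ a, |x a - y a| ≤ ε) :
    |Real.log (∑ a, Real.exp (x a)) - Real.log (∑ a, Real.exp (y a))| ≤ ε :=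
  abs_sub_le_iff.2 ⟨log_sum_exp_sub_le fun a => (abs_sub_le_iff.1 (h a)).1,
    log_sum_exp_sub_le fun a => (abs_sub_le_iff.1 (h a)).2⟩

/-- Averaging against a probability vector is `1`-Lipschitz for the sup norm. -/
lemma abs_sum_mul_sub_sum_mul_le {S : Type*} [Fintype S] {p V W : S → ℝ} {ε : ℝ}
    (hp : ∀ s, 0 ≤ p s) (hp1 : ∑ s, p s = 1) (h : ∀ s, |V s - W s| ≤ ε) :
    |∑ s, p s * V s - ∑ s, p s * W s| ≤ ε := by
  rw [← Finset.sum_sub_distrib]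
  calc |∑ s, (p s * V s - p s * W s)| ≤ ∑ s, p s * ε := by
        refine (Finset.abs_sum_le_sum_abs _ _).trans (Finset.sum_le_sum fun s _ => ?_)
        rw [← mul_sub, abs_mul, abs_of_nonneg (hp s)]
        exact mul_le_mul_of_nonneg_left (h s) (hp s)
    _ = ε := by rw [← Finset.sum_mul, hp1, one_mul]

/-- Convergence of soft value iteration (Proposition E.1): after `T` iterations of
the soft Bellman value operator starting from `0`, the softmax policy of the
induced Q-function is `γ^T (R̄ + λ log|A|)/(λ(1−γ))`-close to the optimal policy. -/
theorem soft_value_iteration_policy_convergence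
    {S A : Type*} [Fintype S] [Nonempty S] [Fintype A] [Nonempty A]
    (r : S → A → ℝ) (P : S → A → S → ℝ)
    (hP_nonneg : ∀ s a s', 0 ≤ P s a s')
    (hP_sum : ∀ s a, ∑ s', P s a s' = 1)
    (γ : ℝ) (hγ : γ ∈ Set.Ico (0 : ℝ) 1) (lam : ℝ) (hlam : 0 < lam)
    (Rbar : ℝ) (hRbar : 0 ≤ Rbar) (hr : ∀ s a, |r s a| ≤ Rbar)
    (𝒯 : (S → ℝ) → S → ℝ)
    (h𝒯 : ∀ V s, 𝒯 V s = lam * Real.log (∑ a,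
      Real.exp ((r s a + γ * ∑ s', P s a s' * V s') / lam)))
    (Vstar : S → ℝ) (hVstar : 𝒯 Vstar = Vstar)
    (T : ℕ) (VT : S → ℝ) (hVT : VT = 𝒯^[T] fun _ => 0)
    (QT Qstar : S → A → ℝ)
    (hQT : ∀ s a, QT s a = r s a + γ * ∑ s', P s a s' * VT s')
    (hQstar : ∀ s a, Qstar s a = r s a + γ * ∑ s', P s a s' * Vstar s')
    (polT polStar : S → A → ℝ)
    (hpolT : ∀ s a, polT s a =
      Real.exp (QT s a / lam) / ∑ b, Real.exp (QT s b / lam))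
    (hpolStar : ∀ s a, polStar s a =
      Real.exp (Qstar s a / lam) / ∑ b, Real.exp (Qstar s b / lam)) :
    ∀ s a, |polT s a - polStar s a| ≤
      γ ^ T * (Rbar + lam * Real.log (Fintype.card A)) / (lam * (1 - γ)) := by
  obtain ⟨hγ0, hγ1⟩ := hγ
  have hQ {V W : S → ℝ} {ε : ℝ} (h : ∀ s, |V s - W s| ≤ ε) (s : S) (a : A) :
      |(r s a + γ * ∑ s', P s a s' * V s') / lam - (r s a + γ * ∑ s', P s a s' * W s') / lam| ≤
        γ * ε / lam := by
    rw [← sub_div, add_sub_add_left_eq_sub, ← mul_sub, abs_div, abs_mul, abs_of_nonneg hγ0,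
      abs_of_pos hlam]
    gcongr
    exact abs_sum_mul_sub_sum_mul_le (hP_nonneg s a) (hP_sum s a) h
  have hcontr {V W : S → ℝ} {ε : ℝ} (h : ∀ s, |V s - W s| ≤ ε) (s : S) :
      |𝒯 V s - 𝒯 W s| ≤ γ * ε := by
    rw [h𝒯, h𝒯, ← mul_sub, abs_mul, abs_of_pos hlam, ← le_div_iff₀' hlam]
    exact abs_log_sum_exp_sub_le (hQ h s)
  have hzero (s : S) : |𝒯 (fun _ => 0) s| ≤ Rbar + lam * Real.log (Fintype.card A) := by
    have hlse := abs_log_sum_exp_sub_le (x := fun a => r s a / lam) (y := fun _ => 0)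
      (ε := Rbar / lam) fun a => by
        rw [sub_zero, abs_div, abs_of_pos hlam]
        gcongr
        exact hr s a
    have hcard : 0 ≤ Real.log (Fintype.card A) := Real.log_natCast_nonneg _
    simp only [Real.exp_zero, Finset.sum_const, Finset.card_univ, nsmul_eq_mul, mul_one] at hlse
    rw [h𝒯, abs_mul, abs_of_pos hlam]
    simp only [mul_zero, Finset.sum_const_zero, add_zero]
    have hle := mul_le_mul_of_nonneg_left
      ((abs_sub_abs_le_abs_sub _ _).trans hlse) hlam.le
    rw [abs_of_nonneg hcard, mul_sub, mul_div_cancel₀ _ hlam.ne'] at hle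
    linarith
  set C := Rbar + lam * Real.log (Fintype.card A)
  have hstar (s : S) : |0 - Vstar s| ≤ C / (1 - γ) := by
    obtain ⟨m, hm⟩ := Finite.exists_max fun s => |Vstar s|
    have hdist := hcontr (V := Vstar) (W := fun _ => 0) (by simpa using hm) m
    rw [hVstar] at hdist
    rw [zero_sub, abs_neg, le_div_iff₀ (by linarith)]
    have hM : |Vstar m| * (1 - γ) ≤ C := by
      linarith [abs_sub_abs_le_abs_sub (Vstar m) (𝒯 (fun _ => 0) m), hzero m]
    exact (mul_le_mul_of_nonneg_right (hm s) (by linarith)).trans hM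
  have hiter (n : ℕ) : ∀ s, |(𝒯^[n] fun _ => 0) s - Vstar s| ≤ γ ^ n * (C / (1 - γ)) := by
    induction n with
    | zero => simpa using hstar
    | succ n ih =>
      intro s
      rw [Function.iterate_succ_apply', pow_succ', mul_assoc]
      simpa only [hVstar] using hcontr ih s
  subst hVT
  intro s a
  rw [hpolT, hpolStar]
  simp only [hQT, hQstar]
  refine (abs_softmax_sub_le (hQ (hiter T) s) a).trans ?_
  have hbound : 0 ≤ γ ^ T * (C / (1 - γ)) := (abs_nonneg _).trans (hiter T s)
  calc γ * (γ ^ T * (C / (1 - γ))) / lam ≤ γ ^ T * (C / (1 - γ)) / lam :=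
        div_le_div_of_nonneg_right (mul_le_of_le_one_left hbound hγ1.le) hlam.le
    _ = γ ^ T * C / (lam * (1 - γ)) := by
        rw [← mul_div_assoc, div_div, mul_comm (1 - γ)]
end

section
/- Fix finite nonempty sets S (states) and A (actions), a reward function r : S → A → ℝ, a transition kernel P : S → A → S → ℝ such that P(s,a,·) is a probability vector for every (s,a), a discount factor γ ∈ [0,1), a regularization parameter λ > 0, and R̄ ≥ 0 with |r(s,a)| ≤ R̄ for all (s,a). Define the soft Bellman optimality operator T mapping Q : S → A → ℝ to (T Q)(s,a) = r(s,a) + γ·Σ_{s'} P(s,a,s')·λ·log( Σ_{a'} exp(Q(s',a')/λ) ). If Q : S → A → ℝ is a fixed point of T, i.e. T Q = Q, then for all (s,a): −R̄/(1−γ) ≤ Q(s,a) ≤ (R̄ + λ·log|A|)/(1−γ). -/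
/-- The scaled log-sum-exp dominates every lower bound of its arguments. -/
lemma le_mul_log_sum_exp_div {A : Type*} [Fintype A] [Nonempty A] {lam : ℝ} (hlam : 0 < lam)
    {q : A → ℝ} {m : ℝ} (hm : ∀ a, m ≤ q a) :
    m ≤ lam * Real.log (∑ a, Real.exp (q a / lam)) := by
  obtain ⟨a⟩ := ‹Nonempty A›
  rw [← div_le_iff₀' hlam]
  calc m / lam ≤ q a / lam := by gcongr; exact hm a
    _ = Real.log (Real.exp (q a / lam)) := (Real.log_exp _).symm
    _ ≤ Real.log (∑ a, Real.exp (q a / lam)) :=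
      Real.log_le_log (Real.exp_pos _) <|
        Finset.single_le_sum (f := fun a => Real.exp (q a / lam))
          (fun _ _ => (Real.exp_pos _).le) (Finset.mem_univ a)

/-- The scaled log-sum-exp exceeds an upper bound of its arguments by at most
`lam * log |A|`. -/
lemma mul_log_sum_exp_div_le {A : Type*} [Fintype A] [Nonempty A] {lam : ℝ} (hlam : 0 < lam)
    {q : A → ℝ} {M : ℝ} (hM : ∀ a, q a ≤ M) :
    lam * Real.log (∑ a, Real.exp (q a / lam)) ≤ M + lam * Real.log (Fintype.card A) := by
  have hpos : 0 < ∑ a, Real.exp (q a / lam) :=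
    Finset.sum_pos (fun _ _ => Real.exp_pos _) Finset.univ_nonempty
  have hsum : ∑ a, Real.exp (q a / lam) ≤ Fintype.card A * Real.exp (M / lam) := by
    calc ∑ a, Real.exp (q a / lam) ≤ ∑ _a : A, Real.exp (M / lam) := by
          gcongr with a; exact hM a
      _ = Fintype.card A * Real.exp (M / lam) := by simp
  calc lam * Real.log (∑ a, Real.exp (q a / lam))
      ≤ lam * Real.log (Fintype.card A * Real.exp (M / lam)) := by gcongr
    _ = M + lam * Real.log (Fintype.card A) := by
      rw [Real.log_mul (by simp) (Real.exp_ne_zero _), Real.log_exp]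
      field_simp
      ring

/-- Two-sided bounds on the fixed point of the soft Bellman optimality operator
(the optimal soft Q-function): `−R̄/(1−γ) ≤ Q* ≤ (R̄ + λ log|A|)/(1−γ)`. -/
theorem soft_Q_fixed_point_bounds
    {S A : Type*} [Fintype S] [Nonempty S] [Fintype A] [Nonempty A]
    (r : S → A → ℝ) (P : S → A → S → ℝ)
    (hP_nonneg : ∀ s a s', 0 ≤ P s a s')
    (hP_sum : ∀ s a, ∑ s', P s a s' = 1)
    (γ : ℝ) (hγ : γ ∈ Set.Ico (0 : ℝ) 1) (lam : ℝ) (hlam : 0 < lam)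
    (Rbar : ℝ) (hRbar : 0 ≤ Rbar) (hr : ∀ s a, |r s a| ≤ Rbar)
    (T : (S → A → ℝ) → S → A → ℝ)
    (hT : ∀ Q s a, T Q s a = r s a + γ * ∑ s', P s a s' *
      (lam * Real.log (∑ a', Real.exp (Q s' a' / lam)))) :
    ∀ Q : S → A → ℝ, T Q = Q →
      ∀ s a, -Rbar / (1 - γ) ≤ Q s a ∧
        Q s a ≤ (Rbar + lam * Real.log (Fintype.card A)) / (1 - γ) := by
  intro Q hQ
  obtain ⟨hγ0, hγ1⟩ := hγ
  have h1γ : 0 < 1 - γ := sub_pos.mpr hγ1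
  have hfix : ∀ s a, Q s a = r s a + γ * ∑ s', P s a s' *
      (lam * Real.log (∑ a', Real.exp (Q s' a' / lam))) := fun s a => by rw [← hT, hQ]
  obtain ⟨⟨s₀, a₀⟩, hmin⟩ := Finite.exists_min (fun x : S × A => Q x.1 x.2)
  obtain ⟨⟨s₁, a₁⟩, hmax⟩ := Finite.exists_max (fun x : S × A => Q x.1 x.2)
  have hlow : -Rbar / (1 - γ) ≤ Q s₀ a₀ := by
    have hmean : Q s₀ a₀ ≤ ∑ s', P s₀ a₀ s' *
        (lam * Real.log (∑ a', Real.exp (Q s' a' / lam))) := by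
      calc Q s₀ a₀ = ∑ s', P s₀ a₀ s' * Q s₀ a₀ := by rw [← Finset.sum_mul, hP_sum, one_mul]
        _ ≤ _ := Finset.sum_le_sum fun s' _ => mul_le_mul_of_nonneg_left
          (le_mul_log_sum_exp_div hlam fun a' => hmin (s', a')) (hP_nonneg _ _ _)
    rw [div_le_iff₀ h1γ]
    linarith [hfix s₀ a₀, neg_le_of_abs_le (hr s₀ a₀), mul_le_mul_of_nonneg_left hmean hγ0]
  have hupp : Q s₁ a₁ ≤ (Rbar + lam * Real.log (Fintype.card A)) / (1 - γ) := by
    have hmean : ∑ s', P s₁ a₁ s' * (lam * Real.log (∑ a', Real.exp (Q s' a' / lam))) ≤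
        Q s₁ a₁ + lam * Real.log (Fintype.card A) := by
      calc _ ≤ ∑ s', P s₁ a₁ s' * (Q s₁ a₁ + lam * Real.log (Fintype.card A)) :=
          Finset.sum_le_sum fun s' _ => mul_le_mul_of_nonneg_left
            (mul_log_sum_exp_div_le hlam fun a' => hmax (s', a')) (hP_nonneg _ _ _)
        _ = _ := by rw [← Finset.sum_mul, hP_sum, one_mul]
    have hlog : 0 ≤ lam * Real.log (Fintype.card A) :=
      mul_nonneg hlam.le (Real.log_natCast_nonneg _)
    rw [le_div_iff₀ h1γ]
    linarith [hfix s₁ a₁, le_of_abs_le (hr s₁ a₁), mul_le_mul_of_nonneg_left hmean hγ0,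
      mul_le_of_le_one_left hlog hγ1.le]
  exact fun s a => ⟨hlow.trans (hmin (s, a)), (hmax (s, a)).trans hupp⟩
end

section
/- Let λ > 0, n ≥ 1, and q₁, q₂ : Fin n → ℝ. Then Σ_a |σ_λ(q₁)(a) − σ_λ(q₂)(a)| ≤ (1/λ)·max_a |q₁(a) − q₂(a)|, where σ_λ(q)(a) = exp(q(a)/λ) / Σ_b exp(q(b)/λ); in particular max_a |σ_λ(q₁)(a) − σ_λ(q₂)(a)| ≤ (1/λ)·max_a |q₁(a) − q₂(a)|. -/
open Finset in
/-- The weighted covariance of `h` with a vector of values in `[-1, 1]` is at most `sup |h|`. -/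
lemma abs_weighted_covariance_le {ι : Type*} [Fintype ι] (w h s : ι → ℝ) (M : ℝ)
    (hw : ∀ a, 0 ≤ w a) (hM : 0 ≤ M) (hh : ∀ a, |h a| ≤ M) (hs : ∀ a, |s a| ≤ 1) :
    |(∑ a, s a * (w a * h a)) * (∑ a, w a) - (∑ a, s a * w a) * (∑ a, w a * h a)| ≤
      M * (∑ a, w a) ^ 2 := by
  set Z := ∑ a, w a with hZ
  set C := ∑ a, w a * h a with hC
  have hZ0 : 0 ≤ Z := sum_nonneg fun a _ => hw a
  have hcov : (∑ a, s a * (w a * h a)) * Z - (∑ a, s a * w a) * C =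
      ∑ a, s a * w a * (Z * h a - C) := by
    rw [sum_mul, sum_mul, ← sum_sub_distrib]
    exact sum_congr rfl fun a _ => by ring
  have hsw : ∑ a, s a ^ 2 * w a ≤ Z := sum_le_sum fun a _ =>
    mul_le_of_le_one_left (hw a) ((sq_le_one_iff_abs_le_one _).2 (hs a))
  have hvar : ∑ a, w a * (Z * h a - C) ^ 2 = Z * (Z * ∑ a, w a * h a ^ 2 - C ^ 2) := by
    have hexp : ∑ a, w a * (Z * h a - C) ^ 2 =
        Z ^ 2 * (∑ a, w a * h a ^ 2) - 2 * Z * C * (∑ a, w a * h a) + C ^ 2 * ∑ a, w a := by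
      simp only [mul_sum, ← sum_sub_distrib, ← sum_add_distrib]
      exact sum_congr rfl fun a _ => by ring
    rw [hexp, ← hC, ← hZ]
    ring
  have hmom : ∑ a, w a * h a ^ 2 ≤ M ^ 2 * Z := by
    rw [hZ, mul_sum]
    refine sum_le_sum fun a _ => ?_
    rw [mul_comm]
    exact mul_le_mul_of_nonneg_right (sq_le_sq' (abs_le.1 (hh a)).1 (abs_le.1 (hh a)).2) (hw a)
  have hcs : (∑ a, s a * w a * (Z * h a - C)) ^ 2 ≤
      (∑ a, s a ^ 2 * w a) * ∑ a, w a * (Z * h a - C) ^ 2 :=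
    sum_sq_le_sum_mul_sum_of_sq_le_mul _ (fun a _ => mul_nonneg (sq_nonneg _) (hw a))
      (fun a _ => mul_nonneg (hw a) (sq_nonneg _)) (fun a _ => le_of_eq (by ring))
  rw [hcov]
  refine abs_le_of_sq_le_sq (hcs.trans ?_) (by positivity)
  calc (∑ a, s a ^ 2 * w a) * ∑ a, w a * (Z * h a - C) ^ 2
      ≤ Z * ∑ a, w a * (Z * h a - C) ^ 2 :=
        mul_le_mul_of_nonneg_right hsw (sum_nonneg fun a _ => mul_nonneg (hw a) (sq_nonneg _))
    _ = Z ^ 2 * (Z * ∑ a, w a * h a ^ 2 - C ^ 2) := by rw [hvar]; ring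
    _ ≤ Z ^ 2 * (Z * (M ^ 2 * Z)) := by
        refine mul_le_mul_of_nonneg_left ?_ (sq_nonneg _)
        nlinarith [mul_le_mul_of_nonneg_left hmom hZ0, sq_nonneg C]
    _ = (M * Z ^ 2) ^ 2 := by ring

open Finset in
/-- The softmax map at temperature one is 1-Lipschitz from the sup norm to the `ℓ¹` norm. -/
lemma sum_abs_softmax_sub_le {ι : Type*} [Fintype ι] [Nonempty ι] (x y : ι → ℝ) (M : ℝ)
    (hxy : ∀ a, |x a - y a| ≤ M) :
    ∑ a, |Real.exp (x a) / (∑ b, Real.exp (x b)) - Real.exp (y a) / (∑ b, Real.exp (y b))| ≤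
      M := by
  have hM : 0 ≤ M := (abs_nonneg _).trans (hxy (Classical.arbitrary ι))
  set s : ι → ℝ := fun a => (SignType.sign (Real.exp (x a) / (∑ b, Real.exp (x b)) -
    Real.exp (y a) / (∑ b, Real.exp (y b))) : ℝ) with hs
  have hs1 : ∀ a, |s a| ≤ 1 := by
    intro a
    simp only [hs]
    generalize SignType.sign (Real.exp (x a) / (∑ b, Real.exp (x b)) -
      Real.exp (y a) / (∑ b, Real.exp (y b))) = t
    cases t <;> simp
  set w : ℝ → ι → ℝ := fun t a => Real.exp (y a + t * (x a - y a)) with hw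
  have hZ : ∀ t, 0 < ∑ a, w t a := fun t =>
    sum_pos (fun a _ => Real.exp_pos _) univ_nonempty
  have hdw : ∀ t a, HasDerivAt (fun t => w t a) (w t a * (x a - y a)) t := by
    intro t a
    have h := (((hasDerivAt_id t).mul_const (x a - y a)).const_add (y a)).exp
    simpa [hw] using h
  have hderiv : ∀ t, HasDerivAt (fun t => (∑ a, s a * w t a) / ∑ a, w t a)
      (((∑ a, s a * (w t a * (x a - y a))) * (∑ a, w t a) -
        (∑ a, s a * w t a) * (∑ a, w t a * (x a - y a))) / (∑ a, w t a) ^ 2) t := fun t =>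
    (HasDerivAt.fun_sum fun a _ => (hdw t a).const_mul (s a)).fun_div
      (HasDerivAt.fun_sum fun a _ => hdw t a) (hZ t).ne'
  have hbound := convex_univ.norm_image_sub_le_of_norm_hasDerivWithin_le (C := M)
    (fun t _ => (hderiv t).hasDerivWithinAt)
    (fun t _ => by
      rw [Real.norm_eq_abs, abs_div, abs_of_nonneg (sq_nonneg (∑ a, w t a)),
        div_le_iff₀ (pow_pos (hZ t) 2)]
      exact abs_weighted_covariance_le (w t) (fun a => x a - y a) s M
        (fun a => (Real.exp_pos _).le) hM hxy hs1)
    (Set.mem_univ (0 : ℝ)) (Set.mem_univ (1 : ℝ))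
  simp only [sub_zero, norm_one, mul_one, Real.norm_eq_abs] at hbound
  refine le_trans (le_of_eq ?_) ((le_abs_self _).trans hbound)
  simp only [hw, one_mul, zero_mul, add_zero, add_sub_cancel, sum_div, ← sum_sub_distrib]
  refine sum_congr rfl fun a _ => ?_
  rw [mul_div_assoc, mul_div_assoc, ← mul_sub]
  exact (sign_mul_self _).symm

/-- Lipschitz property of the softmax map from the sup norm to the ℓ¹ norm:
`‖σ_λ(q₁) − σ_λ(q₂)‖₁ ≤ (1/λ)‖q₁ − q₂‖_∞`, hence also in sup norm. -/
theorem softmax_lipschitz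
    (lam : ℝ) (hlam : 0 < lam) (n : ℕ) (hn : 1 ≤ n) (q₁ q₂ : Fin n → ℝ) :
    (∑ a, |Real.exp (q₁ a / lam) / (∑ b, Real.exp (q₁ b / lam)) -
        Real.exp (q₂ a / lam) / (∑ b, Real.exp (q₂ b / lam))| ≤
      (1 / lam) * ⨆ a, |q₁ a - q₂ a|) ∧
    ((⨆ a, |Real.exp (q₁ a / lam) / (∑ b, Real.exp (q₁ b / lam)) -
        Real.exp (q₂ a / lam) / (∑ b, Real.exp (q₂ b / lam))|) ≤
      (1 / lam) * ⨆ a, |q₁ a - q₂ a|) := by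
  have : Nonempty (Fin n) := ⟨⟨0, hn⟩⟩
  have hl1 := sum_abs_softmax_sub_le (fun a => q₁ a / lam) (fun a => q₂ a / lam)
    ((1 / lam) * ⨆ a, |q₁ a - q₂ a|) fun a => by
      rw [← sub_div, abs_div, abs_of_pos hlam, div_eq_inv_mul, one_div]
      exact mul_le_mul_of_nonneg_left
        (le_ciSup (f := fun a => |q₁ a - q₂ a|) (Set.finite_range _).bddAbove a)
        (inv_nonneg.2 hlam.le)
  exact ⟨hl1, ciSup_le fun a => (Finset.single_le_sum (fun b _ => abs_nonneg
    (Real.exp (q₁ b / lam) / (∑ b, Real.exp (q₁ b / lam)) -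
      Real.exp (q₂ b / lam) / (∑ b, Real.exp (q₂ b / lam)))) (Finset.mem_univ a)).trans hl1⟩
end

section
/- Let n ≥ 1, 0 < l ≤ 1, and δ ≥ 0. Let p, q : Fin n → ℝ be probability vectors with p(a) ≥ l and q(a) ≥ l/2 for all a, and |p(a) − q(a)| ≤ δ for all a. Then |H(p) − H(q)| ≤ n·log(1/l)·δ + (2/l)·δ, where H(p) = −Σ_a p(a)·log p(a). -/
/-- `Real.log` is Lipschitz with constant `1 / m` on `[m, ∞)`. -/
theorem abs_log_sub_log_le {m x y : ℝ} (hm : 0 < m) (hx : m ≤ x) (hy : m ≤ y) :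
    |Real.log x - Real.log y| ≤ |x - y| / m := by
  have one_sided : ∀ {u v : ℝ}, m ≤ u → m ≤ v → Real.log u - Real.log v ≤ |u - v| / m := by
    intro u v hu hv
    have hu0 : 0 < u := hm.trans_le hu
    have hv0 : 0 < v := hm.trans_le hv
    calc Real.log u - Real.log v = Real.log (u / v) := (Real.log_div hu0.ne' hv0.ne').symm
      _ ≤ u / v - 1 := Real.log_le_sub_one_of_pos (div_pos hu0 hv0)
      _ = (u - v) / v := by field_simp
      _ ≤ |u - v| / v := by gcongr; exact le_abs_self _
      _ ≤ |u - v| / m := by gcongr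
  refine abs_sub_le_iff.2 ⟨one_sided hx hy, ?_⟩
  rw [abs_sub_comm]
  exact one_sided hy hx

/-- Entropy difference bound for two nearby probability vectors bounded away
from zero: `|H(p) − H(q)| ≤ n·log(1/l)·δ + (2/l)·δ`. -/
theorem entropy_difference_bound
    (n : ℕ) (hn : 1 ≤ n) (l : ℝ) (hl0 : 0 < l) (hl1 : l ≤ 1)
    (δ : ℝ) (hδ : 0 ≤ δ)
    (p q : Fin n → ℝ)
    (hpl : ∀ a, l ≤ p a) (hql : ∀ a, l / 2 ≤ q a)
    (hpsum : ∑ a, p a = 1) (hqsum : ∑ a, q a = 1)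
    (hpq : ∀ a, |p a - q a| ≤ δ) :
    |(-∑ a, p a * Real.log (p a)) - (-∑ a, q a * Real.log (q a))| ≤
      n * Real.log (1 / l) * δ + (2 / l) * δ := by
  have hp1 : ∀ a, p a ≤ 1 := fun a => hpsum ▸
    Finset.single_le_sum (fun b _ => hl0.le.trans (hpl b)) (Finset.mem_univ a)
  have hterm : ∀ a, |q a * Real.log (q a) - p a * Real.log (p a)| ≤
      Real.log (1 / l) * δ + q a * (2 / l * δ) := by
    intro a
    have hp0 : 0 < p a := hl0.trans_le (hpl a)
    have hq0 : 0 < q a := (half_pos hl0).trans_le (hql a)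
    have hlogp : |Real.log (p a)| ≤ Real.log (1 / l) := by
      rw [abs_of_nonpos (Real.log_nonpos hp0.le (hp1 a)), one_div, Real.log_inv]
      exact neg_le_neg (Real.log_le_log hl0 (hpl a))
    have hlog : |Real.log (q a) - Real.log (p a)| ≤ 2 / l * δ := by
      calc |Real.log (q a) - Real.log (p a)| ≤ |q a - p a| / (l / 2) :=
            abs_log_sub_log_le (half_pos hl0) (hql a) (by linarith [hpl a])
        _ ≤ δ / (l / 2) := by gcongr; rw [abs_sub_comm]; exact hpq a
        _ = 2 / l * δ := by field_simp
    calc |q a * Real.log (q a) - p a * Real.log (p a)|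
        = |Real.log (p a) * (q a - p a) + q a * (Real.log (q a) - Real.log (p a))| := by
          congr 1; ring
      _ ≤ |Real.log (p a)| * |q a - p a| + q a * |Real.log (q a) - Real.log (p a)| := by
          refine (abs_add_le _ _).trans_eq ?_
          rw [abs_mul, abs_mul, abs_of_pos hq0]
      _ ≤ Real.log (1 / l) * δ + q a * (2 / l * δ) := by
          gcongr
          · exact (abs_nonneg _).trans hlogp
          · rw [abs_sub_comm]; exact hpq a
  calc |(-∑ a, p a * Real.log (p a)) - (-∑ a, q a * Real.log (q a))|
      = |∑ a, (q a * Real.log (q a) - p a * Real.log (p a))| := by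
        rw [Finset.sum_sub_distrib]; congr 1; ring
    _ ≤ ∑ a, (Real.log (1 / l) * δ + q a * (2 / l * δ)) :=
        (Finset.abs_sum_le_sum_abs _ _).trans (Finset.sum_le_sum fun a _ => hterm a)
    _ = n * Real.log (1 / l) * δ + (2 / l) * δ := by
        rw [Finset.sum_add_distrib, ← Finset.sum_mul, ← Finset.sum_mul, hqsum]
        simp [mul_assoc]
end

section
/- Let S and A be finite nonempty sets, γ ∈ [0,1), λ > 0, x₀ ∈ ℝ, and R̄, K₁, K₂ ≥ 0. Let π : S → A → ℝ be a policy (each π(s,·) a probability vector). Let r : ℝ → S → A → ℝ and P : ℝ → S → A → S → ℝ be such that P(x)(s,a,·) is a probability vector for every x, s, a, the maps x ↦ r(x)(s,a) and x ↦ P(x)(s,a,s') are differentiable at x₀, |r(x₀)(s,a)| ≤ R̄, |∂ₓr(x₀)(s,a)| ≤ K₂, and |∂ₓP(x₀)(s,a,s')| ≤ K₁·P(x₀)(s,a,s') for all s, a, s'. Suppose Q : ℝ → S → A → ℝ and V : ℝ → S → ℝ satisfy, for every x ∈ ℝ, the entropy-regularized Bellman equations for π: Q(x)(s,a) = r(x)(s,a)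 + γ·Σ_{s'} P(x)(s,a,s')·V(x)(s') and V(x)(s) = Σ_a π(s,a)·Q(x)(s,a) + λ·H(π(s,·)), and that x ↦ Q(x)(s,a) is differentiable at x₀ for every (s,a). Then for all (s,a): |∂ₓQ(x₀)(s,a)| ≤ K₂/(1−γ) + γ·K₁·(R̄ + λ·log|A|)/(1−γ)². -/
theorem abs_sum_mul_le_of_abs_le {ι : Type*} [Fintype ι] {p f g : ι → ℝ} {K M : ℝ}
    (hp : ∑ i, p i = 1) (hg : ∀ i, |g i| ≤ K * p i) (hf : ∀ i, |f i| ≤ M) :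
    |∑ i, g i * f i| ≤ K * M :=
  calc |∑ i, g i * f i| ≤ ∑ i, |g i * f i| := Finset.abs_sum_le_sum_abs _ _
    _ ≤ ∑ i, K * M * p i := by
      refine Finset.sum_le_sum fun i _ => ?_
      rw [abs_mul]
      calc |g i| * |f i| ≤ K * p i * M :=
            mul_le_mul (hg i) (hf i) (abs_nonneg _) ((abs_nonneg _).trans (hg i))
        _ = K * M * p i := by ring
    _ = K * M := by rw [← Finset.mul_sum, hp, mul_one]

theorem abs_average_le {ι : Type*} [Fintype ι] {p f : ι → ℝ} {M : ℝ}
    (hp_nonneg : ∀ i, 0 ≤ p i) (hp : ∑ i, p i = 1) (hf : ∀ i, |f i| ≤ M) :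
    |∑ i, p i * f i| ≤ M := by
  simpa using abs_sum_mul_le_of_abs_le (K := 1) hp
    (fun i => by rw [abs_of_nonneg (hp_nonneg i), one_mul]) hf

theorem entropy_nonneg {ι : Type*} [Fintype ι] {p : ι → ℝ}
    (hp_nonneg : ∀ i, 0 ≤ p i) (hp : ∑ i, p i = 1) :
    0 ≤ -∑ i, p i * Real.log (p i) := by
  rw [← Finset.sum_neg_distrib]
  refine Finset.sum_nonneg fun i _ => ?_
  have h1 : p i ≤ 1 := hp ▸ Finset.single_le_sum (fun j _ => hp_nonneg j) (Finset.mem_univ i)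
  simpa [Real.negMulLog] using Real.negMulLog_nonneg (hp_nonneg i) h1

theorem entropy_le_log_card {ι : Type*} [Fintype ι] [Nonempty ι] {p : ι → ℝ}
    (hp_nonneg : ∀ i, 0 ≤ p i) (hp : ∑ i, p i = 1) :
    -∑ i, p i * Real.log (p i) ≤ Real.log (Fintype.card ι) := by
  have hn : (0 : ℝ) < Fintype.card ι := by exact_mod_cast Fintype.card_pos
  have key : ∀ i, -(p i * Real.log (p i)) ≤
      p i * Real.log (Fintype.card ι) + ((Fintype.card ι : ℝ)⁻¹ - p i) := by
    intro i
    rcases (hp_nonneg i).eq_or_lt with h | h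
    · rw [← h]; simp
    · have h1 := Real.one_sub_inv_le_log_of_pos (mul_pos hn h)
      rw [Real.log_mul hn.ne' h.ne'] at h1
      have h2 := mul_le_mul_of_nonneg_left h1 h.le
      have h3 : p i * (1 - ((Fintype.card ι : ℝ) * p i)⁻¹) =
          p i - (Fintype.card ι : ℝ)⁻¹ := by
        field_simp
      linarith
  calc -∑ i, p i * Real.log (p i) = ∑ i, -(p i * Real.log (p i)) := by
        rw [Finset.sum_neg_distrib]
    _ ≤ ∑ i, (p i * Real.log (Fintype.card ι) + ((Fintype.card ι : ℝ)⁻¹ - p i)) :=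
        Finset.sum_le_sum fun i _ => key i
    _ = Real.log (Fintype.card ι) := by
        rw [Finset.sum_add_distrib, ← Finset.sum_mul, Finset.sum_sub_distrib, hp]
        simp [hn.ne']

theorem abs_le_div_of_self_bound {ι : Type*} [Finite ι] {f : ι → ℝ} {γ C : ℝ}
    (hγ : γ < 1) (h : ∀ M, 0 ≤ M → (∀ i, |f i| ≤ M) → ∀ i, |f i| ≤ C + γ * M) (i : ι) :
    |f i| ≤ C / (1 - γ) := by
  have : Nonempty ι := ⟨i⟩
  obtain ⟨j, hj⟩ := Finite.exists_max fun i => |f i|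
  have hmax := h |f j| (abs_nonneg _) hj j
  refine (hj i).trans ?_
  rw [le_div_iff₀ (by linarith)]
  linarith

/-- Uniform bound on the parameter-derivative of the soft Q-function:
`|∂ₓQ^π(s,a)| ≤ K₂/(1−γ) + γ K₁ (R̄ + λ log|A|)/(1−γ)²`. -/
theorem soft_Q_derivative_bound
    {S A : Type*} [Fintype S] [Nonempty S] [Fintype A] [Nonempty A]
    (γ : ℝ) (hγ : γ ∈ Set.Ico (0 : ℝ) 1) (lam : ℝ) (hlam : 0 < lam) (x₀ : ℝ)
    (Rbar K₁ K₂ : ℝ) (hRbar : 0 ≤ Rbar) (hK₁ : 0 ≤ K₁) (hK₂ : 0 ≤ K₂)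
    (pol : S → A → ℝ)
    (hpol_nonneg : ∀ s a, 0 ≤ pol s a) (hpol_sum : ∀ s, ∑ a, pol s a = 1)
    (r : ℝ → S → A → ℝ) (P : ℝ → S → A → S → ℝ)
    (hP_nonneg : ∀ x s a s', 0 ≤ P x s a s')
    (hP_sum : ∀ x s a, ∑ s', P x s a s' = 1)
    (r' : S → A → ℝ) (P' : S → A → S → ℝ)
    (hr' : ∀ s a, HasDerivAt (fun x => r x s a) (r' s a) x₀)
    (hP' : ∀ s a s', HasDerivAt (fun x => P x s a s') (P' s a s') x₀)
    (hrB : ∀ s a, |r x₀ s a| ≤ Rbar)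
    (hr'B : ∀ s a, |r' s a| ≤ K₂)
    (hP'B : ∀ s a s', |P' s a s'| ≤ K₁ * P x₀ s a s')
    (Q : ℝ → S → A → ℝ) (V : ℝ → S → ℝ)
    (hQ : ∀ x s a, Q x s a = r x s a + γ * ∑ s', P x s a s' * V x s')
    (hV : ∀ x s, V x s = ∑ a, pol s a * Q x s a +
      lam * (-∑ a, pol s a * Real.log (pol s a)))
    (Qd : S → A → ℝ)
    (hQd : ∀ s a, HasDerivAt (fun x => Q x s a) (Qd s a) x₀) :
    ∀ s a, |Qd s a| ≤ K₂ / (1 - γ) +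
      γ * K₁ * (Rbar + lam * Real.log (Fintype.card A)) / (1 - γ) ^ 2 := by
  obtain ⟨hγ0, hγ1⟩ := hγ
  have hγ' : 0 < 1 - γ := by linarith
  set L := Real.log (Fintype.card A)
  set B := (Rbar + lam * L) / (1 - γ) with hB
  have hVB : ∀ s, |V x₀ s| ≤ B := by
    refine abs_le_div_of_self_bound hγ1 fun M _ hVM s => ?_
    have hQM : ∀ a, |Q x₀ s a| ≤ Rbar + γ * M := fun a => by
      rw [hQ]
      refine (abs_add_le _ _).trans (add_le_add (hrB s a) ?_)
      rw [abs_mul, abs_of_nonneg hγ0]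
      exact mul_le_mul_of_nonneg_left
        (abs_average_le (hP_nonneg x₀ s a) (hP_sum x₀ s a) hVM) hγ0
    have hH : |lam * (-∑ a, pol s a * Real.log (pol s a))| ≤ lam * L := by
      rw [abs_mul, abs_of_pos hlam,
        abs_of_nonneg (entropy_nonneg (hpol_nonneg s) (hpol_sum s))]
      exact mul_le_mul_of_nonneg_left
        (entropy_le_log_card (hpol_nonneg s) (hpol_sum s)) hlam.le
    have hA := abs_average_le (hpol_nonneg s) (hpol_sum s) hQM
    rw [hV]
    linarith [abs_add_le (∑ a, pol s a * Q x₀ s a)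
      (lam * (-∑ a, pol s a * Real.log (pol s a)))]
  have hVd : ∀ s, HasDerivAt (fun x => V x s) (∑ a, pol s a * Qd s a) x₀ := fun s => by
    simp only [hV]
    exact (HasDerivAt.fun_sum fun a _ => (hQd s a).const_mul (pol s a)).add_const _
  have hQd_eq : ∀ s a, Qd s a = r' s a + γ * (∑ s', P' s a s' * V x₀ s' +
      ∑ s', P x₀ s a s' * ∑ b, pol s' b * Qd s' b) := fun s a => by
    refine (hQd s a).unique ?_
    simp only [hQ _ s a]
    rw [← Finset.sum_add_distrib]
    exact (hr' s a).add
      ((HasDerivAt.fun_sum fun s' _ => (hP' s a s').mul (hVd s')).const_mul γ)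
  have hbound : ∀ z : S × A, |Qd z.1 z.2| ≤ (K₂ + γ * (K₁ * B)) / (1 - γ) := by
    refine abs_le_div_of_self_bound hγ1 fun M _ hQM z => ?_
    obtain ⟨s, a⟩ := z
    have h1 := abs_sum_mul_le_of_abs_le (hP_sum x₀ s a) (hP'B s a) hVB
    have h2 := abs_average_le (hP_nonneg x₀ s a) (hP_sum x₀ s a) fun s' =>
      abs_average_le (hpol_nonneg s') (hpol_sum s') fun b => hQM (s', b)
    have h3 := mul_le_mul_of_nonneg_left ((abs_add_le _ _).trans (add_le_add h1 h2)) hγ0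
    change |Qd s a| ≤ _
    rw [hQd_eq]
    refine (abs_add_le _ _).trans ?_
    rw [abs_mul, abs_of_nonneg hγ0]
    linarith [hr'B s a]
  intro s a
  refine (hbound (s, a)).trans_eq ?_
  rw [hB]
  field_simp
end
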